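/- arXiv:1710.10465 — 11 statements merged into one kernel-verified Lean document; each statement's English description precedes it below -/
import Mathlib

section
/- Let R be a commutative domain. Then every divisible R-module M is R-projective, i.e., for every ideal I of R, every R-homomorphism from M to R/I factors through the canonical projection R → R/I. -/
/-- A module `M` over a commutative ring `R` is `R`-projective if for every ideal `I` of `R`,
every `R`-homomorphism `M → R/I` factors through the canonical projection `R → R/I`. -/
def IsRProjective (R : Type*) [CommRing R] (M : Type*) [AddCommGroup M] [Module R M] : Prop :=
  ∀ (I : Ideal R) (f : M →ₗ[R] R ⧸ I), ∃ g : M →ₗ[R] R, f = (Submodule.mkQ I).comp g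

/-- Over a commutative domain, every divisible module is `R`-projective. -/
theorem divisible_isRProjective (R : Type*) [CommRing R] [IsDomain R]
    (M : Type*) [AddCommGroup M] [Module R M]
    (hdiv : ∀ r : R, r ≠ 0 → ∀ m : M, ∃ m' : M, r • m' = m) :
    IsRProjective R M := by
  intro I f
  by_cases hI : I = ⊥
  · subst hI
    refine ⟨(Submodule.quotEquivOfEqBot (⊥ : Ideal R) rfl).toLinearMap.comp f, ?_⟩
    ext m
    obtain ⟨x, hx⟩ := Submodule.mkQ_surjective (⊥ : Ideal R) (f m)
    simp only [LinearMap.comp_apply, LinearEquiv.coe_coe]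
    rw [← hx]
    rw [Submodule.mkQ_apply, Submodule.quotEquivOfEqBot_apply_mk, Submodule.mkQ_apply]
  · obtain ⟨r, hr, hr0⟩ := Submodule.exists_mem_ne_zero_of_ne_bot hI
    refine ⟨0, ?_⟩
    ext m
    obtain ⟨m', rfl⟩ := hdiv r hr0 m
    obtain ⟨x, hx⟩ := Submodule.mkQ_surjective I (f m')
    rw [map_smul, ← hx, ← map_smul, LinearMap.comp_zero, LinearMap.zero_apply,
      Submodule.mkQ_apply, Submodule.Quotient.mk_eq_zero, smul_eq_mul]
    exact I.mul_mem_right x hr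
end

section
/- Let K be a field and R the subalgebra of K^ω of eventually constant sequences, with idempotents e_i as above. If I is an ideal of R contained in Soc(R), then I = I_A := Σ_{i∈A} e_iR for some subset A ⊆ ω; in particular I is a semisimple projective R-module. -/
/-- The unital `K`-subalgebra of `K^ω` consisting of all eventually constant sequences. -/
def evConst (K : Type*) [Field K] : Subalgebra K (ℕ → K) where
  carrier := {x | ∃ (N : ℕ) (c : K), ∀ n, N ≤ n → x n = c}
  add_mem' := by
    rintro x y ⟨N, c, hN⟩ ⟨M, d, hM⟩
    exact ⟨max N M, c + d, fun n hn => by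
      simp [Pi.add_apply, hN n (le_trans (le_max_left N M) hn),
        hM n (le_trans (le_max_right N M) hn)]⟩
  mul_mem' := by
    rintro x y ⟨N, c, hN⟩ ⟨M, d, hM⟩
    exact ⟨max N M, c * d, fun n hn => by
      simp [Pi.mul_apply, hN n (le_trans (le_max_left N M) hn),
        hM n (le_trans (le_max_right N M) hn)]⟩
  algebraMap_mem' := fun a => ⟨0, a, fun n _ => rfl⟩

/-- The ring of eventually constant sequences in `K^ω`, as a type. -/
def EvRing (K : Type*) [Field K] : Type _ := evConst K

instance (K : Type*) [Field K] : CommRing (EvRing K) :=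
  inferInstanceAs (CommRing (evConst K))

instance (K : Type*) [Field K] : Algebra K (EvRing K) :=
  inferInstanceAs (Algebra K (evConst K))

/-- The underlying sequence of an element of `EvRing K`. -/
def EvRing.seq {K : Type*} [Field K] (x : EvRing K) : ℕ → K :=
  Subtype.val (p := fun x => x ∈ evConst K) x

/-- The idempotent `e i ∈ EvRing K` whose `i`-th component is `1` and all
other components are `0`. -/
def evIdem (K : Type*) [Field K] (i : ℕ) : EvRing K :=
  (⟨fun n => if n = i then 1 else 0, ⟨i + 1, 0, fun n hn => if_neg (by omega)⟩⟩ :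
    evConst K)

/-- The socle of a module: the sum of all its simple submodules. -/
def moduleSocle (R : Type*) [Ring R] (M : Type*) [AddCommGroup M] [Module R M] :
    Submodule R M :=
  sSup {p : Submodule R M | IsSimpleModule R p}

namespace EvRingAux

variable {K : Type*} [Field K]

theorem seq_ext {x y : EvRing K} (h : ∀ n, x.seq n = y.seq n) : x = y :=
  Subtype.ext (funext h)

theorem seq_mul (x y : EvRing K) (n : ℕ) : (x * y).seq n = x.seq n * y.seq n := rfl

theorem seq_add (x y : EvRing K) (n : ℕ) : (x + y).seq n = x.seq n + y.seq n := rfl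

theorem seq_zero (n : ℕ) : (0 : EvRing K).seq n = 0 := rfl

theorem seq_idem (i n : ℕ) : (evIdem K i).seq n = if n = i then 1 else 0 := rfl

theorem seq_algebraMap (a : K) (n : ℕ) : (algebraMap K (EvRing K) a).seq n = a := rfl

theorem seq_sum (s : Finset ℕ) (f : ℕ → EvRing K) (n : ℕ) :
    (∑ i ∈ s, f i).seq n = ∑ i ∈ s, (f i).seq n := by
  classical
  induction s using Finset.induction_on with
  | empty => simp [seq_zero]
  | insert a s ha ih => rw [Finset.sum_insert ha, Finset.sum_insert ha, seq_add, ih]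

theorem idem_ne_zero (i : ℕ) : evIdem K i ≠ 0 := by
  intro h
  have := congrArg (fun x : EvRing K => x.seq i) h
  simp [seq_idem, seq_zero] at this

/-- The nonvanishing of a component puts the idempotent into the ideal. -/
theorem idem_mem {I : Ideal (EvRing K)} {x : EvRing K} (hx : x ∈ I) {i : ℕ}
    (hi : x.seq i ≠ 0) : evIdem K i ∈ I := by
  have h : evIdem K i = (algebraMap K (EvRing K) (x.seq i)⁻¹ * evIdem K i) * x := by
    apply seq_ext
    intro n
    simp only [seq_mul, seq_idem, seq_algebraMap]
    split_ifs with h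
    · subst h; field_simp
    · simp
  rw [h]
  exact I.mul_mem_left _ hx

theorem exists_seq_ne {x : EvRing K} (hx : x ≠ 0) : ∃ i, x.seq i ≠ 0 := by
  by_contra! h
  exact hx (seq_ext h)

theorem exists_idem_mem {I : Ideal (EvRing K)} (hI : I ≠ ⊥) : ∃ i, evIdem K i ∈ I := by
  obtain ⟨x, hx, h0⟩ := Submodule.exists_mem_ne_zero_of_ne_bot hI
  obtain ⟨i, hi⟩ := exists_seq_ne h0
  exact ⟨i, idem_mem hx hi⟩

theorem simple_span (i : ℕ) :
    IsSimpleModule (EvRing K) (Ideal.span {evIdem K i} : Ideal (EvRing K)) := by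
  rw [isSimpleModule_iff_isAtom]
  refine ⟨by simpa using idem_ne_zero i, fun J hJ => ?_⟩
  by_contra hne
  obtain ⟨j, hj⟩ := exists_idem_mem hne
  obtain ⟨a, ha⟩ := Ideal.mem_span_singleton'.1 (hJ.le hj)
  have h := congrArg (fun x : EvRing K => x.seq j) ha
  simp only [seq_mul, seq_idem] at h
  have hij : j = i := by
    by_contra hh
    simp [hh] at h
  subst hij
  exact hJ.not_ge ((Ideal.span_singleton_le_iff_mem _).2 hj)

/-- The ideal of finitely supported sequences. -/
def finIdeal (K : Type*) [Field K] : Ideal (EvRing K) where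
  carrier := {x | (Function.support x.seq).Finite}
  add_mem' := by
    intro x y hx hy
    exact (hx.union hy).subset (Function.support_add x.seq y.seq)
  zero_mem' := by
    refine Set.finite_empty.subset fun n hn => hn (seq_zero n)
  smul_mem' := by
    intro c x hx
    refine Set.Finite.subset hx fun n hn h => hn ?_
    change c.seq n * x.seq n = 0
    rw [h, mul_zero]

theorem fin_of_mem {I : Ideal (EvRing K)} (hI : I ≤ finIdeal K) {x : EvRing K} (hx : x ∈ I) :
    (Function.support x.seq).Finite := hI hx

theorem socle_le : moduleSocle (EvRing K) (EvRing K) ≤ finIdeal K := by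
  refine sSup_le fun p hp => ?_
  have hat : IsAtom p := isSimpleModule_iff_isAtom.1 hp
  obtain ⟨i, hi⟩ := exists_idem_mem (I := p) hat.1
  have hle : Ideal.span {evIdem K i} ≤ p := (Ideal.span_singleton_le_iff_mem _).2 hi
  have heq : Ideal.span {evIdem K i} = p :=
    (hat.le_iff.1 hle).resolve_left (by simpa using idem_ne_zero i)
  rw [← heq, Ideal.span_singleton_le_iff_mem]
  refine (Set.finite_singleton i).subset fun n hn => ?_
  by_contra h
  exact hn ((seq_idem i n).trans (if_neg h))

theorem eq_sum {x : EvRing K} (hx : (Function.support x.seq).Finite) :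
    x = ∑ i ∈ hx.toFinset, x * evIdem K i := by
  apply seq_ext
  intro n
  rw [seq_sum]
  simp only [seq_mul, seq_idem]
  by_cases h : x.seq n = 0 <;> simp [h]

theorem ideal_eq {I : Ideal (EvRing K)} (hI : I ≤ finIdeal K) :
    I = ⨆ i ∈ {i | evIdem K i ∈ I}, Ideal.span {evIdem K i} := by
  apply le_antisymm
  · intro x hx
    rw [eq_sum (fin_of_mem hI hx)]
    refine Ideal.sum_mem _ fun i hi => Ideal.mul_mem_left _ _ ?_
    have hi' : evIdem K i ∈ I := idem_mem hx (by simpa using hi)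
    exact Submodule.mem_iSup_of_mem i
      (Submodule.mem_iSup_of_mem hi' (Ideal.mem_span_singleton_self _))
  · exact iSup₂_le fun i hi => (Ideal.span_singleton_le_iff_mem _).2 hi

theorem supp_aux {x : EvRing K} (hx : (Function.support x.seq).Finite) (i : ℕ)
    (hi : x * evIdem K i ≠ 0) : i ∈ hx.toFinset := by
  rw [Set.Finite.mem_toFinset]
  intro h0
  apply hi
  apply seq_ext
  intro n
  rw [seq_mul, seq_idem, seq_zero]
  split_ifs with h
  · subst h; rw [h0, zero_mul]
  · rw [mul_zero]

/-- The section `x ↦ (x e_i)_i`. -/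
noncomputable def sect {I : Ideal (EvRing K)} (hI : I ≤ finIdeal K) :
    I →ₗ[EvRing K] (ℕ →₀ EvRing K) where
  toFun x := Finsupp.onFinset (fin_of_mem hI x.2).toFinset (fun i => x.1 * evIdem K i)
    (supp_aux (fin_of_mem hI x.2))
  map_add' x y := by
    ext1 i
    simp [add_mul]
  map_smul' c x := by
    ext1 i
    simp [mul_assoc]

open Classical in
/-- The candidate generators of `I`. -/
noncomputable def gen (I : Ideal (EvRing K)) (i : ℕ) : I :=
  if h : evIdem K i ∈ I then ⟨evIdem K i, h⟩ else 0

theorem projective {I : Ideal (EvRing K)} (hI : I ≤ finIdeal K) :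
    Module.Projective (EvRing K) I := by
  refine Module.Projective.of_split (sect hI) (Finsupp.linearCombination (EvRing K) (gen I)) ?_
  ext1 x
  apply Subtype.ext
  have hx : (Function.support x.1.seq).Finite := fin_of_mem hI x.2
  have h1 : (Finsupp.linearCombination (EvRing K) (gen I)) (sect hI x)
      = ∑ i ∈ hx.toFinset, (x.1 * evIdem K i) • gen I i := by
    rw [Finsupp.linearCombination_apply]
    exact Finsupp.onFinset_sum (supp_aux hx) (fun i => zero_smul _ _)
  rw [LinearMap.comp_apply, h1, LinearMap.id_apply, AddSubmonoidClass.coe_finsetSum]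
  conv_rhs => rw [eq_sum hx]
  refine Finset.sum_congr rfl fun i hi => ?_
  have hi' : evIdem K i ∈ I := idem_mem x.2 (by simpa using hi)
  simp only [gen, dif_pos hi']
  apply seq_ext
  intro n
  change x.1.seq n * (evIdem K i).seq n * (evIdem K i).seq n = x.1.seq n * (evIdem K i).seq n
  rw [seq_idem]
  split_ifs <;> simp

theorem semisimple {I : Ideal (EvRing K)} (hI : I ≤ finIdeal K) :
    IsSemisimpleModule (EvRing K) I := by
  rw [ideal_eq hI]
  refine isSemisimpleModule_biSup_of_isSemisimpleModule_submodule fun i _ => ?_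
  have := simple_span (K := K) i
  infer_instance

end EvRingAux

/-- Every ideal of the ring of eventually constant sequences contained in the socle is of
the form `I_A = Σ_{i∈A} e_i R` for some `A ⊆ ω`; in particular it is a semisimple
projective module. -/
theorem evRing_ideal_in_socle (K : Type*) [Field K] (I : Ideal (EvRing K))
    (hI : I ≤ moduleSocle (EvRing K) (EvRing K)) :
    (∃ A : Set ℕ, I = ⨆ i ∈ A, Ideal.span {evIdem K i}) ∧
    IsSemisimpleModule (EvRing K) I ∧ Module.Projective (EvRing K) I := by
  have h := hI.trans EvRingAux.socle_le
  exact ⟨⟨_, EvRingAux.ideal_eq h⟩, EvRingAux.semisimple h, EvRingAux.projective h⟩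
end

section
/- Let K be a field and R the subalgebra of K^ω of eventually constant sequences. If I is an ideal of R not contained in Soc(R), then I = fR for an idempotent f ∈ R whose components are eventually equal to 1. -/
theorem EvRing.seq_ext {K : Type*} [Field K] {x y : EvRing K}
    (h : ∀ n, EvRing.seq x n = EvRing.seq y n) : x = y :=
  Subtype.ext (funext h)

theorem EvRing.seq_mul {K : Type*} [Field K] (x y : EvRing K) (n : ℕ) :
    EvRing.seq (x * y) n = EvRing.seq x n * EvRing.seq y n := rfl

theorem EvRing.seq_sub {K : Type*} [Field K] (x y : EvRing K) (n : ℕ) :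
    EvRing.seq (x - y) n = EvRing.seq x n - EvRing.seq y n := rfl

theorem EvRing.seq_zero {K : Type*} [Field K] (n : ℕ) :
    EvRing.seq (0 : EvRing K) n = 0 := rfl

theorem EvRing.seq_idem {K : Type*} [Field K] (i n : ℕ) :
    EvRing.seq (evIdem K i) n = if n = i then 1 else 0 := rfl

/-- Constant sequences. -/
def EvRing.const {K : Type*} [Field K] (a : K) : EvRing K :=
  (⟨fun _ => a, ⟨0, a, fun _ _ => rfl⟩⟩ : evConst K)

theorem EvRing.seq_const {K : Type*} [Field K] (a : K) (n : ℕ) :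
    EvRing.seq (EvRing.const a) n = a := rfl

theorem EvRing.idem_mem {K : Type*} [Field K] (J : Ideal (EvRing K)) {y : EvRing K}
    (hy : y ∈ J) {i : ℕ} (hi : EvRing.seq y i ≠ 0) : evIdem K i ∈ J := by
  have : evIdem K i = (EvRing.const (EvRing.seq y i)⁻¹ * evIdem K i) * y := by
    apply EvRing.seq_ext
    intro n
    simp only [EvRing.seq_mul, EvRing.seq_const, EvRing.seq_idem]
    split_ifs with h
    · subst h; simp [hi]
    · simp
  rw [this]
  exact J.mul_mem_left _ hy

theorem EvRing.mem_of_fin {K : Type*} [Field K] (J : Ideal (EvRing K)) (N : ℕ) :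
    ∀ z : EvRing K, (∀ n, N ≤ n → EvRing.seq z n = 0) →
      (∀ i, EvRing.seq z i ≠ 0 → evIdem K i ∈ J) → z ∈ J := by
  induction N with
  | zero =>
    intro z hz _
    have : z = 0 := EvRing.seq_ext fun n => hz n (Nat.zero_le n)
    rw [this]; exact J.zero_mem
  | succ N ih =>
    intro z hz hJ
    have h1 : z * evIdem K N ∈ J := by
      by_cases h : EvRing.seq z N = 0
      · have : z * evIdem K N = 0 := by
          apply EvRing.seq_ext
          intro n
          simp only [EvRing.seq_mul, EvRing.seq_idem, EvRing.seq_zero]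
          split_ifs with h'
          · subst h'; simp [h]
          · simp
        rw [this]; exact J.zero_mem
      · exact J.mul_mem_left _ (hJ N h)
    have h2 : z - z * evIdem K N ∈ J := by
      apply ih
      · intro n hn
        simp only [EvRing.seq_sub, EvRing.seq_mul, EvRing.seq_idem]
        split_ifs with h'
        · simp
        · simp [hz n (by omega)]
      · intro i hi
        apply hJ
        intro h0
        apply hi
        simp [EvRing.seq_sub, EvRing.seq_mul, h0]
    have := J.add_mem h2 h1
    simpa using this

theorem EvRing.idem_mem_socle {K : Type*} [Field K] (i : ℕ) :
    evIdem K i ∈ moduleSocle (EvRing K) (EvRing K) := by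
  have hs : IsSimpleModule (EvRing K) (Ideal.span {evIdem K i} : Ideal (EvRing K)) := by
    rw [isSimpleModule_iff_isAtom]
    refine ⟨?_, ?_⟩
    · intro h
      rw [Ideal.span_singleton_eq_bot] at h
      have := congrArg (fun x => EvRing.seq x i) h
      simp [EvRing.seq_idem, EvRing.seq_zero] at this
    · intro J hJ
      by_contra hne
      obtain ⟨y, hy, hy0⟩ := Submodule.exists_mem_ne_zero_of_ne_bot hne
      obtain ⟨r, hr⟩ := Ideal.mem_span_singleton'.1 (hJ.le hy)
      have hi : EvRing.seq y i ≠ 0 := by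
        intro h
        apply hy0
        apply EvRing.seq_ext
        intro n
        by_cases hn : n = i
        · rw [hn, h, EvRing.seq_zero]
        · rw [← hr]; simp [EvRing.seq_mul, EvRing.seq_idem, EvRing.seq_zero, hn]
      apply hJ.not_ge
      exact (Ideal.span_singleton_le_iff_mem J).2 (EvRing.idem_mem J hy hi)
  have hle : (Ideal.span {evIdem K i} : Ideal (EvRing K)) ≤
      moduleSocle (EvRing K) (EvRing K) := le_sSup hs
  exact hle (Ideal.mem_span_singleton_self _)

/-- Every ideal of the ring of eventually constant sequences not contained in the socle is
generated by an idempotent `f` whose components are eventually equal to `1`. -/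
theorem evRing_ideal_not_in_socle (K : Type*) [Field K] (I : Ideal (EvRing K))
    (hI : ¬ I ≤ moduleSocle (EvRing K) (EvRing K)) :
    ∃ f : EvRing K, IsIdempotentElem f ∧ (∃ N : ℕ, ∀ n, N ≤ n → EvRing.seq f n = 1) ∧
      I = Ideal.span {f} := by
  classical
  obtain ⟨x, hx, hxs⟩ := Set.not_subset.1 hI
  obtain ⟨N, c, hN⟩ : ∃ (N : ℕ) (c : K), ∀ n, N ≤ n → EvRing.seq x n = c := x.2
  have hc : c ≠ 0 := by
    rintro rfl
    exact hxs (EvRing.mem_of_fin _ N x hN fun i _ => EvRing.idem_mem_socle i)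
  let s : ℕ → K := fun n => if ∃ y ∈ I, EvRing.seq y n ≠ 0 then 1 else 0
  have hsN : ∀ n, N ≤ n → s n = 1 := fun n hn =>
    if_pos ⟨x, hx, by rw [hN n hn]; exact hc⟩
  let f : EvRing K := (⟨s, ⟨N, 1, hsN⟩⟩ : evConst K)
  have hf : ∀ n, EvRing.seq f n = if ∃ y ∈ I, EvRing.seq y n ≠ 0 then 1 else 0 := fun _ => rfl
  have hmul : ∀ y ∈ I, y = y * f := by
    intro y hy
    apply EvRing.seq_ext
    intro n
    rw [EvRing.seq_mul, hf]
    split_ifs with h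
    · simp
    · push Not at h
      simp [h y hy]
  have hg : EvRing.const c⁻¹ * x ∈ I := I.mul_mem_left _ hx
  have hfI : f ∈ I := by
    have : f - EvRing.const c⁻¹ * x ∈ I := by
      apply EvRing.mem_of_fin I N
      · intro n hn
        have : EvRing.seq f n = 1 := hsN n hn
        simp [EvRing.seq_sub, EvRing.seq_mul, EvRing.seq_const, this, hN n hn, hc]
      · intro i hi
        by_cases h : ∃ y ∈ I, EvRing.seq y i ≠ 0
        · obtain ⟨y, hy, hyi⟩ := h
          exact EvRing.idem_mem I hy hyi
        · exfalso
          apply hi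
          rw [EvRing.seq_sub, hf, if_neg h]
          push Not at h
          simp [h _ hg]
    simpa using I.add_mem this hg
  refine ⟨f, (hmul f hfI).symm, ⟨N, hsN⟩, le_antisymm ?_ ?_⟩
  · intro y hy
    rw [hmul y hy]
    exact Ideal.mul_mem_left _ _ (Ideal.mem_span_singleton_self f)
  · exact (Ideal.span_singleton_le_iff_mem I).2 hfI
end

section
/- Let K be a field and R the subalgebra of K^ω of eventually constant sequences. Then R is hereditary: every ideal of R is a projective R-module. -/
/-- Evaluation at the `k`-th component, as a ring homomorphism. -/
noncomputable def evAt (K : Type*) [Field K] (k : ℕ) : EvRing K →+* K :=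
  (Pi.evalRingHom (fun _ : ℕ => K) k).comp (evConst K).val.toRingHom

theorem evAt_ext {K : Type*} [Field K] {x y : EvRing K}
    (h : ∀ k, evAt K k x = evAt K k y) : x = y :=
  Subtype.ext (funext h)

/-- Build an element from an eventually constant function. -/
def evMk {K : Type*} [Field K] (f : ℕ → K) (N : ℕ) (c : K) (h : ∀ n, N ≤ n → f n = c) :
    EvRing K := (⟨f, N, c, h⟩ : evConst K)

theorem evAt_evMk {K : Type*} [Field K] (f : ℕ → K) (N : ℕ) (c : K)
    (h : ∀ n, N ≤ n → f n = c) (k : ℕ) : evAt K k (evMk f N c h) = f k := rfl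

theorem evAt_evIdem {K : Type*} [Field K] (i k : ℕ) :
    evAt K k (evIdem K i) = if k = i then 1 else 0 := rfl

theorem ev_exists {K : Type*} [Field K] (x : EvRing K) :
    ∃ (N : ℕ) (c : K), ∀ n, N ≤ n → evAt K n x = c := x.2

theorem evIdem_mem {K : Type*} [Field K] {I : Ideal (EvRing K)} {x : EvRing K} (hx : x ∈ I)
    {k : ℕ} (hk : evAt K k x ≠ 0) : evIdem K k ∈ I := by
  have : evIdem K k = algebraMap K (EvRing K) (evAt K k x)⁻¹ * evIdem K k * x := by
    apply evAt_ext
    intro j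
    rw [map_mul, map_mul, evAt_evIdem]
    have : evAt K j (algebraMap K (EvRing K) (evAt K k x)⁻¹) = (evAt K k x)⁻¹ := rfl
    rw [this]
    split_ifs with h
    · subst h; field_simp
    · simp
  rw [this]
  exact I.mul_mem_left _ hx

theorem ev_projective_of {K : Type*} [Field K] (I : Ideal (EvRing K)) (g : ℕ → I)
    (hfin : ∀ x ∈ I, (Function.support fun n => x * (g n : EvRing K)).Finite)
    (hg : ∀ x ∈ I, ∀ k, evAt K k x ≠ 0 →
      ∃ n, ∀ m, evAt K k (g m : EvRing K) = if m = n then 1 else 0) :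
    Module.Projective (EvRing K) I := by
  let i : I →ₗ[EvRing K] (ℕ →₀ EvRing K) :=
    { toFun := fun x => Finsupp.ofSupportFinite _ (hfin x.1 x.2)
      map_add' := fun x y => by
        ext n
        exact add_mul _ _ _
      map_smul' := fun r x => by
        ext n
        exact mul_assoc _ _ _ }
  have hi : ∀ x n, i x n = (x : EvRing K) * (g n : EvRing K) := fun x n => rfl
  refine Module.Projective.of_split i (Finsupp.linearCombination (EvRing K) g) ?_
  ext1 x
  apply Subtype.ext
  apply evAt_ext
  intro k
  simp only [LinearMap.comp_apply, LinearMap.id_apply, Finsupp.linearCombination_apply,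
    Finsupp.sum, AddSubmonoidClass.coe_finset_sum, Submodule.coe_smul, smul_eq_mul, map_sum,
    map_mul, hi]
  by_cases hk : evAt K k (x : EvRing K) = 0
  · simp [hk]
  · obtain ⟨n, hn⟩ := hg x.1 x.2 k hk
    rw [Finset.sum_eq_single n]
    · simp [hn]
    · intro m _ hm
      simp [hn, hm]
    · intro h
      rw [Finsupp.notMem_support_iff, hi] at h
      have := congrArg (evAt K k) h
      rw [map_mul, map_zero] at this
      rw [this, zero_mul]

/-- The ring of eventually constant sequences is hereditary:
every ideal is a projective module. -/
theorem evRing_hereditary (K : Type*) [Field K] :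
    ∀ I : Ideal (EvRing K), Module.Projective (EvRing K) I := by
  intro I
  classical
  by_cases hI : ∀ x ∈ I, ∃ N, ∀ n, N ≤ n → evAt K n x = 0
  · refine ev_projective_of I
      (fun n => if h : evIdem K n ∈ I then ⟨evIdem K n, h⟩ else 0) ?_ ?_
    · intro x hx
      obtain ⟨N, hN⟩ := hI x hx
      refine (Set.finite_lt_nat N).subset ?_
      intro n hn
      by_contra hlt
      apply hn
      apply evAt_ext
      intro k
      dsimp only
      split_ifs with h
      · rw [map_mul, evAt_evIdem, map_zero]
        split_ifs with hk
        · subst hk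
          rw [hN k (not_lt.mp hlt), zero_mul]
        · simp
      · simp
    · intro x hx k hk
      refine ⟨k, fun m => ?_⟩
      by_cases hm : m = k
      · subst hm
        simp [evIdem_mem hx hk, evAt_evIdem]
      · rw [if_neg hm]
        split_ifs with h
        · simp [evAt_evIdem, Ne.symm hm]
        · simp
  · push Not at hI
    obtain ⟨u, hu, hu0⟩ := hI
    obtain ⟨N, c, hc⟩ := ev_exists u
    have hc0 : c ≠ 0 := by
      obtain ⟨n, hn, h⟩ := hu0 N
      rwa [hc n hn] at h
    let t : EvRing K := evMk (fun n => if N ≤ n then 1 else 0) N 1 (fun n hn => if_pos hn)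
    have htk : ∀ k, evAt K k t = if N ≤ k then 1 else 0 := fun k => rfl
    have ht : t ∈ I := by
      have : t = algebraMap K (EvRing K) c⁻¹ * t * u := by
        apply evAt_ext
        intro j
        rw [map_mul, map_mul, htk]
        have : evAt K j (algebraMap K (EvRing K) c⁻¹) = c⁻¹ := rfl
        rw [this]
        split_ifs with h
        · rw [hc j h]; field_simp
        · simp
      rw [this]
      exact I.mul_mem_left _ hu
    refine ev_projective_of I (fun n => if n = N then ⟨t, ht⟩ else
      if h : n < N ∧ evIdem K n ∈ I then ⟨evIdem K n, h.2⟩ else 0) ?_ ?_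
    · intro x hx
      refine (Set.finite_le_nat N).subset ?_
      intro n hn
      by_contra hlt
      have h1 : N < n := not_le.mp hlt
      apply hn
      simp [h1.ne', h1.not_gt]
    · intro x hx k hk
      by_cases hkN : N ≤ k
      · refine ⟨N, fun m => ?_⟩
        by_cases hm : m = N
        · simp [hm, htk, hkN]
        · simp only [hm, if_false]
          split_ifs with h
          · have : k ≠ m := by omega
            simp [evAt_evIdem, this]
          · simp
      · refine ⟨k, fun m => ?_⟩
        by_cases hm : m = N
        · have : N ≠ k := by omega
          simp [hm, htk, hkN, this]
        · simp only [hm, if_false]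
          by_cases hmk : m = k
          · subst hmk
            simp [evIdem_mem hx hk, evAt_evIdem, not_le.mp hkN]
          · rw [if_neg hmk]
            split_ifs with h
            · simp [evAt_evIdem, Ne.symm hmk]
            · simp
end

section
/- Let K be a field and R the subalgebra of K^ω of eventually constant sequences. Then every simple R-module is injective. -/
/-- `EvRing K` is von Neumann regular. -/
theorem evRing_regular (K : Type*) [Field K] (a : EvRing K) :
    ∃ b : EvRing K, a * b * a = a := by
  obtain ⟨x, N, c, hN⟩ := a
  refine ⟨(⟨fun n => (x n)⁻¹, N, c⁻¹, fun n hn => congrArg _ (hN n hn)⟩ : evConst K), ?_⟩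
  apply Subtype.ext
  funext n
  exact mul_inv_mul_cancel (x n)

/-- Every simple module over the ring of eventually constant sequences is injective. -/
theorem evRing_simple_injective (K : Type*) [Field K]
    (M : Type v) [AddCommGroup M] [Module (EvRing K) M]
    (hM : IsSimpleModule (EvRing K) M) :
    Module.Injective (EvRing K) M := by
  apply Module.Baer.injective
  intro I g
  by_cases hg : ∀ x, g x = 0
  · exact ⟨0, fun x hx => by simp [hg]⟩
  push Not at hg
  obtain ⟨⟨a, ha⟩, hga⟩ := hg
  obtain ⟨b, hb⟩ := evRing_regular K a
  have heI : a * b ∈ I := I.mul_mem_right b ha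
  have h1 : g ⟨a, ha⟩ = (a * b) • g ⟨a, ha⟩ := by
    rw [← map_smul]
    congr 1
    exact Subtype.ext hb.symm
  have hid : ∀ m : M, (a * b) • m = m := by
    intro m
    have hker : LinearMap.ker (LinearMap.lsmul (EvRing K) M (a * b)) = ⊥ := by
      rcases eq_bot_or_eq_top (LinearMap.ker (LinearMap.lsmul (EvRing K) M (a * b))) with h | h
      · exact h
      · exfalso
        have : g ⟨a, ha⟩ ∈ LinearMap.ker (LinearMap.lsmul (EvRing K) M (a * b)) := by
          rw [h]; trivial
        rw [LinearMap.mem_ker, LinearMap.lsmul_apply, ← h1] at this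
        exact hga this
    apply LinearMap.ker_eq_bot.mp hker
    rw [LinearMap.lsmul_apply, LinearMap.lsmul_apply, smul_smul]
    congr 1
    rw [← mul_assoc, hb]
  refine ⟨LinearMap.toSpanSingleton (EvRing K) M (g ⟨a * b, heI⟩), fun x hx => ?_⟩
  rw [LinearMap.toSpanSingleton_apply, ← hid (g ⟨x, hx⟩), ← map_smul, ← map_smul]
  congr 1
  exact Subtype.ext (mul_comm x (a * b))
end

section
/- Let K be a field and R the subalgebra of K^ω of eventually constant sequences, with idempotents e_i as above and S = R/Soc(R). Then every simple R-module is isomorphic either to e_iR for a (unique) i < ω or to S, the modules e_iR (i < ω) are pairwise non-isomorphic simple projective modules, and S is a simple module that is not projective. -/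
namespace EvAux

variable {K : Type*} [Field K]

theorem seq_ext {x y : EvRing K} (h : ∀ n, x.seq n = y.seq n) : x = y :=
  Subtype.ext (funext h)

theorem seq_mul (x y : EvRing K) (n : ℕ) : (x * y).seq n = x.seq n * y.seq n := rfl

theorem seq_add (x y : EvRing K) (n : ℕ) : (x + y).seq n = x.seq n + y.seq n := rfl

theorem seq_sub (x y : EvRing K) (n : ℕ) : (x - y).seq n = x.seq n - y.seq n := rfl

theorem seq_zero (n : ℕ) : (0 : EvRing K).seq n = 0 := rfl

theorem seq_one (n : ℕ) : (1 : EvRing K).seq n = 1 := rfl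

theorem seq_alg (c : K) (n : ℕ) : (algebraMap K (EvRing K) c).seq n = c := rfl

theorem seq_idem (i n : ℕ) : (evIdem K i).seq n = if n = i then 1 else 0 := rfl

theorem seq_sum (s : Finset ℕ) (f : ℕ → EvRing K) (n : ℕ) :
    (∑ i ∈ s, f i).seq n = ∑ i ∈ s, (f i).seq n := by
  classical
  induction s using Finset.induction_on with
  | empty => simp [seq_zero]
  | insert a s ha ih => rw [Finset.sum_insert ha, Finset.sum_insert ha, seq_add, ih]

theorem ev_exists (x : EvRing K) : ∃ (N : ℕ) (c : K), ∀ n, N ≤ n → x.seq n = c :=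
  Subtype.property (p := fun x => x ∈ evConst K) x

theorem mul_idem (x : EvRing K) (i : ℕ) :
    x * evIdem K i = algebraMap K (EvRing K) (x.seq i) * evIdem K i := by
  apply seq_ext
  intro n
  simp only [seq_mul, seq_idem, seq_alg]
  split_ifs with h
  · rw [h]
  · simp

theorem idem_ne (i : ℕ) : evIdem K i ≠ 0 := by
  intro h
  have := congrArg (fun x : EvRing K => x.seq i) h
  simp [seq_idem, seq_zero] at this

theorem idem_mul_self (i : ℕ) : evIdem K i * evIdem K i = evIdem K i := by
  apply seq_ext
  intro n
  simp [seq_mul, seq_idem]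

theorem idem_mul_ne {i j : ℕ} (h : i ≠ j) : evIdem K i * evIdem K j = 0 := by
  apply seq_ext
  intro n
  simp only [seq_mul, seq_idem, seq_zero]
  split_ifs with h1 h2 <;> simp
  exact h (h1.symm.trans h2)

theorem idem_mem {J : Ideal (EvRing K)} {x : EvRing K} (hx : x ∈ J) {i : ℕ}
    (h : x.seq i ≠ 0) : evIdem K i ∈ J := by
  have : evIdem K i = (algebraMap K (EvRing K) (x.seq i)⁻¹ * evIdem K i) * x := by
    apply seq_ext
    intro n
    simp only [seq_mul, seq_idem, seq_alg]
    split_ifs with h'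
    · rw [h']; field_simp
    · simp
  rw [this]
  exact J.mul_mem_left _ hx

theorem exists_ne {x : EvRing K} (h : x ≠ 0) : ∃ i, x.seq i ≠ 0 := by
  by_contra! hh
  exact h (seq_ext hh)

theorem simple_idem (i : ℕ) : IsSimpleModule (EvRing K) (Ideal.span {evIdem K i}) := by
  rw [isSimpleModule_iff_isAtom]
  refine ⟨fun h => idem_ne (K := K) i (Ideal.span_singleton_eq_bot.mp h), fun J hJ => ?_⟩
  rw [eq_bot_iff]
  intro x hx
  by_contra hne
  obtain ⟨j, hj⟩ := exists_ne (K := K) (x := x) hne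
  obtain ⟨a, ha⟩ := Ideal.mem_span_singleton'.mp (hJ.le hx)
  have hji : j = i := by
    by_contra hji
    apply hj
    rw [← ha, seq_mul, seq_idem, if_neg hji, mul_zero]
  subst hji
  exact hJ.not_ge ((Ideal.span_singleton_le_iff_mem _).mpr (idem_mem hx hj))

/-- Eventually zero sequences. -/
def evZero (K : Type*) [Field K] : Ideal (EvRing K) where
  carrier := {x | ∃ N, ∀ n, N ≤ n → x.seq n = 0}
  add_mem' := by
    rintro x y ⟨N, hN⟩ ⟨M, hM⟩
    refine ⟨max N M, fun n hn => ?_⟩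
    rw [seq_add, hN n (le_trans (le_max_left N M) hn),
      hM n (le_trans (le_max_right N M) hn), add_zero]
  zero_mem' := ⟨0, fun _ _ => rfl⟩
  smul_mem' := by
    rintro c x ⟨N, hN⟩
    refine ⟨N, fun n hn => ?_⟩
    rw [smul_eq_mul, seq_mul, hN n hn, mul_zero]

theorem idem_mem_evZero (i : ℕ) : evIdem K i ∈ evZero K :=
  ⟨i + 1, fun n hn => by rw [seq_idem, if_neg (by omega)]⟩

theorem evZero_le {J : Ideal (EvRing K)} (h : ∀ i, evIdem K i ∈ J) : evZero K ≤ J := by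
  rintro x ⟨N, hN⟩
  have : x = ∑ i ∈ Finset.range N, x * evIdem K i := by
    apply seq_ext
    intro n
    rw [seq_sum]
    simp only [seq_mul, seq_idem, mul_ite, mul_one, mul_zero, Finset.sum_ite_eq,
      Finset.mem_range]
    split_ifs with h'
    · rfl
    · exact hN n (by omega)
  rw [this]
  exact J.sum_mem fun i _ => J.mul_mem_left _ (h i)

theorem socle_eq : moduleSocle (EvRing K) (EvRing K) = evZero K := by
  apply le_antisymm
  · apply sSup_le
    intro p hp
    have hp' : IsAtom p := isSimpleModule_iff_isAtom.mp hp
    obtain ⟨x, hx, hx0⟩ := p.ne_bot_iff.mp hp'.1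
    obtain ⟨i, hi⟩ := exists_ne hx0
    have hle : Ideal.span {evIdem K i} ≤ p :=
      (Ideal.span_singleton_le_iff_mem _).mpr (idem_mem (J := p) hx hi)
    have hne : Ideal.span {evIdem K i} ≠ ⊥ :=
      fun h => idem_ne (K := K) i (Ideal.span_singleton_eq_bot.mp h)
    rcases hp'.le_iff.mp hle with h | h
    · exact absurd h hne
    · rw [← h]
      exact (Ideal.span_singleton_le_iff_mem _).mpr (idem_mem_evZero i)
  · apply evZero_le
    intro i
    exact (le_sSup (simple_idem (K := K) i) :
      Ideal.span {evIdem K i} ≤ moduleSocle (EvRing K) (EvRing K))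
      (Ideal.mem_span_singleton_self _)

theorem one_notMem : (1 : EvRing K) ∉ evZero K := by
  rintro ⟨N, hN⟩
  have := hN N le_rfl
  rw [seq_one] at this
  exact one_ne_zero this

theorem simple_quot : IsSimpleModule (EvRing K) (EvRing K ⧸ evZero K) := by
  rw [isSimpleModule_iff_isCoatom]
  refine ⟨fun h => one_notMem (K := K) (h ▸ Submodule.mem_top), fun J hJ => ?_⟩
  obtain ⟨x, hx, hx'⟩ := SetLike.exists_of_lt hJ
  obtain ⟨N, c, hN⟩ := ev_exists x
  have hc : c ≠ 0 := by
    rintro rfl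
    exact hx' ⟨N, hN⟩
  have h1 : 1 - algebraMap K (EvRing K) c⁻¹ * x ∈ evZero K := by
    refine ⟨N, fun n hn => ?_⟩
    rw [seq_sub, seq_mul, seq_one, seq_alg, hN n hn, inv_mul_cancel₀ hc, sub_self]
  refine (Ideal.eq_top_iff_one J).mpr ?_
  have := J.add_mem (hJ.le h1) (Ideal.mul_mem_left J (algebraMap K (EvRing K) c⁻¹) hx)
  simpa using this

theorem projective_idem (i : ℕ) :
    Module.Projective (EvRing K) (Ideal.span {evIdem K i}) := by
  refine Module.Projective.of_split (R := EvRing K) (M := EvRing K)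
    (Ideal.span {evIdem K i}).subtype
    ((LinearMap.toSpanSingleton (EvRing K) (EvRing K) (evIdem K i)).codRestrict
      (Ideal.span {evIdem K i}) fun x => Ideal.mem_span_singleton'.mpr ⟨x, rfl⟩) ?_
  apply LinearMap.ext
  rintro ⟨x, hx⟩
  apply Subtype.ext
  obtain ⟨a, rfl⟩ := Ideal.mem_span_singleton'.mp hx
  change (a * evIdem K i) * evIdem K i = a * evIdem K i
  rw [mul_assoc, idem_mul_self]

theorem not_iso {i j : ℕ} (hij : i ≠ j) :
    IsEmpty ((Ideal.span {evIdem K i} : Ideal (EvRing K)) ≃ₗ[EvRing K]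
        (Ideal.span {evIdem K j} : Ideal (EvRing K))) := by
  refine ⟨fun f => ?_⟩
  let u : (Ideal.span {evIdem K i} : Ideal (EvRing K)) :=
    ⟨evIdem K i, Ideal.mem_span_singleton_self _⟩
  have hu : evIdem K i • u = u := Subtype.ext (idem_mul_self i)
  have h0 : evIdem K i • f u = 0 := by
    obtain ⟨y, hy⟩ := f u
    obtain ⟨a, rfl⟩ := Ideal.mem_span_singleton'.mp hy
    apply Subtype.ext
    change evIdem K i * (a * evIdem K j) = 0
    rw [mul_left_comm, idem_mul_ne hij, mul_zero]
  rw [← map_smul, hu] at h0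
  have : u = 0 := f.map_eq_zero_iff.mp h0
  exact idem_ne (K := K) i (congrArg Subtype.val this)

theorem not_proj : ¬ Module.Projective (EvRing K) (EvRing K ⧸ evZero K) := by
  intro hP
  obtain ⟨s, hs⟩ := Module.projective_lifting_property (evZero K).mkQ
    (LinearMap.id (R := EvRing K) (M := EvRing K ⧸ evZero K))
    (Submodule.mkQ_surjective _)
  have ha : s ((evZero K).mkQ 1) = 0 := by
    apply seq_ext
    intro i
    have h1 : evIdem K i • s ((evZero K).mkQ 1) = 0 := by
      rw [← map_smul, ← map_smul, smul_eq_mul, mul_one, Submodule.mkQ_apply,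
        (Submodule.Quotient.mk_eq_zero _).mpr (idem_mem_evZero i), map_zero]
    have h2 := congrArg (fun x : EvRing K => x.seq i) h1
    simpa [smul_eq_mul, seq_mul, seq_idem, seq_zero] using h2
  have h := LinearMap.congr_fun hs ((evZero K).mkQ 1)
  rw [LinearMap.comp_apply, ha, map_zero, LinearMap.id_apply] at h
  exact one_notMem (K := K) ((Submodule.Quotient.mk_eq_zero _).mp h.symm)

theorem classify (M : Type*) [AddCommGroup M] [Module (EvRing K) M]
    [IsSimpleModule (EvRing K) M] :
    (∃ i : ℕ, Nonempty (M ≃ₗ[EvRing K] Ideal.span {evIdem K i})) ∨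
        Nonempty (M ≃ₗ[EvRing K] (EvRing K ⧸ evZero K)) := by
  by_cases h : ∃ (i : ℕ) (m : M), evIdem K i • m ≠ 0
  · obtain ⟨i, m, hm⟩ := h
    left
    have := simple_idem (K := K) i
    let f : (Ideal.span {evIdem K i} : Ideal (EvRing K)) →ₗ[EvRing K] M :=
      (LinearMap.toSpanSingleton (EvRing K) M m).comp (Submodule.subtype _)
    have hf : f ≠ 0 := fun h0 => hm
      (LinearMap.congr_fun h0 ⟨evIdem K i, Ideal.mem_span_singleton_self _⟩)
    exact ⟨i, ⟨(LinearEquiv.ofBijective f (LinearMap.bijective_of_ne_zero hf)).symm⟩⟩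
  · push Not at h
    right
    have := simple_quot (K := K)
    have := IsSimpleModule.nontrivial (EvRing K) M
    obtain ⟨m, hm⟩ := _root_.exists_ne (0 : M)
    let f : (EvRing K ⧸ evZero K) →ₗ[EvRing K] M :=
      (evZero K).liftQ (LinearMap.toSpanSingleton (EvRing K) M m)
        (evZero_le fun i => h i m)
    have hf : f ≠ 0 := fun h0 => hm (by
      have h1 : (1 : EvRing K) • m = 0 := LinearMap.congr_fun h0 ((evZero K).mkQ 1)
      rwa [one_smul] at h1)
    exact ⟨(LinearEquiv.ofBijective f (LinearMap.bijective_of_ne_zero hf)).symm⟩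

end EvAux

theorem evConst_simple_classification (K : Type*) [Field K] :
    (∀ (M : Type v) (_ : AddCommGroup M) (_ : Module (EvRing K) M),
      IsSimpleModule (EvRing K) M →
        (∃ i : ℕ, Nonempty (M ≃ₗ[EvRing K] Ideal.span {evIdem K i})) ∨
        Nonempty (M ≃ₗ[EvRing K]
          (EvRing K ⧸ (moduleSocle (EvRing K) (EvRing K) : Ideal (EvRing K))))) ∧
    (∀ i : ℕ, IsSimpleModule (EvRing K) (Ideal.span {evIdem K i}) ∧
      Module.Projective (EvRing K) (Ideal.span {evIdem K i})) ∧
    (∀ i j : ℕ, i ≠ j →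
      IsEmpty ((Ideal.span {evIdem K i} : Ideal (EvRing K)) ≃ₗ[EvRing K]
        (Ideal.span {evIdem K j} : Ideal (EvRing K)))) ∧
    (IsSimpleModule (EvRing K)
        (EvRing K ⧸ (moduleSocle (EvRing K) (EvRing K) : Ideal (EvRing K))) ∧
      ¬ Module.Projective (EvRing K)
        (EvRing K ⧸ (moduleSocle (EvRing K) (EvRing K) : Ideal (EvRing K)))) := by
  rw [EvAux.socle_eq]
  refine ⟨fun M _ _ _ => EvAux.classify M,
    fun i => ⟨EvAux.simple_idem i, EvAux.projective_idem i⟩,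
    fun i j h => EvAux.not_iso h, EvAux.simple_quot, EvAux.not_proj⟩
end

section
/- Let K be a field and R the subalgebra of K^ω of eventually constant sequences. An R-module M is R-projective if and only if M is projective with respect to the canonical projection π : R → R/Soc(R), i.e., every homomorphism f : M → R/Soc(R) factors as f = π ∘ g for some g : M → R. -/
namespace EvRing

variable {K : Type*} [Field K]

theorem seq_ext_s11 {x y : EvRing K} (h : ∀ n, x.seq n = y.seq n) : x = y :=
  Subtype.ext (funext h)

@[simp] theorem seq_add (x y : EvRing K) (n : ℕ) : (x + y).seq n = x.seq n + y.seq n := rfl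
@[simp] theorem seq_sub_s11 (x y : EvRing K) (n : ℕ) : (x - y).seq n = x.seq n - y.seq n := rfl
@[simp] theorem seq_mul_s11 (x y : EvRing K) (n : ℕ) : (x * y).seq n = x.seq n * y.seq n := rfl
@[simp] theorem seq_zero_s11 (n : ℕ) : (0 : EvRing K).seq n = 0 := rfl
@[simp] theorem seq_one (n : ℕ) : (1 : EvRing K).seq n = 1 := rfl
@[simp] theorem seq_algebraMap (a : K) (n : ℕ) : (algebraMap K (EvRing K) a).seq n = a := rfl
@[simp] theorem seq_idem_s11 (i n : ℕ) : (evIdem K i).seq n = if n = i then 1 else 0 := rfl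

/-- Evaluation at `n` as an additive hom. -/
def evalHom (K : Type*) [Field K] (n : ℕ) : EvRing K →+ K where
  toFun x := x.seq n
  map_zero' := rfl
  map_add' _ _ := rfl

theorem seq_sum (s : Finset ℕ) (f : ℕ → EvRing K) (n : ℕ) :
    (∑ i ∈ s, f i).seq n = ∑ i ∈ s, (f i).seq n :=
  map_sum (evalHom K n) f s

theorem exists_lim (x : EvRing K) : ∃ (N : ℕ) (c : K), ∀ n, N ≤ n → x.seq n = c := x.2

/-- Build an element. -/
def mk' (f : ℕ → K) (h : ∃ (N : ℕ) (c : K), ∀ n, N ≤ n → f n = c) : EvRing K :=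
  (⟨f, h⟩ : evConst K)

@[simp] theorem seq_mk' (f : ℕ → K) (h) (n : ℕ) : (mk' f h).seq n = f n := rfl

theorem mem_of_fin_s11 (J : Ideal (EvRing K)) (y : EvRing K) (N : ℕ)
    (hN : ∀ n, N ≤ n → y.seq n = 0) (h : ∀ n, y.seq n ≠ 0 → evIdem K n ∈ J) : y ∈ J := by
  have key : y = ∑ i ∈ Finset.range N, y * evIdem K i := by
    apply seq_ext_s11
    intro n
    rw [seq_sum]
    simp only [seq_mul_s11, seq_idem_s11, mul_ite, mul_one, mul_zero, Finset.sum_ite_eq, Finset.mem_range]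
    split_ifs with hn
    · rfl
    · exact hN n (by omega)
  rw [key]
  refine J.sum_mem fun i _ => ?_
  by_cases hi : y.seq i = 0
  · have : y * evIdem K i = 0 := by
      apply seq_ext_s11
      intro n
      by_cases hn : n = i
      · subst hn; simp [hi]
      · simp [hn]
    rw [this]; exact J.zero_mem
  · exact J.mul_mem_left _ (h i hi)

theorem idem_mem_s11 (J : Ideal (EvRing K)) (y : EvRing K) (hy : y ∈ J) (i : ℕ)
    (hi : y.seq i ≠ 0) : evIdem K i ∈ J := by
  have : evIdem K i = (algebraMap K (EvRing K) (y.seq i)⁻¹ * evIdem K i) * y := by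
    apply seq_ext_s11
    intro n
    by_cases hn : n = i
    · subst hn; simp [hi]
    · simp [hn]
  rw [this]
  exact J.mul_mem_left _ hy

/-- Finitely supported sequences. -/
def finIdeal (K : Type*) [Field K] : Ideal (EvRing K) where
  carrier := {x | ∃ N, ∀ n, N ≤ n → x.seq n = 0}
  add_mem' := by
    rintro x y ⟨N, hN⟩ ⟨M, hM⟩
    exact ⟨max N M, fun n hn => by
      simp [hN n (le_trans (le_max_left N M) hn), hM n (le_trans (le_max_right N M) hn)]⟩
  zero_mem' := ⟨0, fun _ _ => rfl⟩
  smul_mem' := by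
    rintro c x ⟨N, hN⟩
    exact ⟨N, fun n hn => by simp [smul_eq_mul, hN n hn]⟩

theorem idem_simple (i : ℕ) : IsSimpleModule (EvRing K) (Ideal.span {evIdem K i}) := by
  rw [isSimpleModule_iff_isAtom]
  refine ⟨?_, ?_⟩
  · intro h
    rw [Ideal.span_singleton_eq_bot] at h
    have := congrArg (fun x => x.seq i) h
    simp at this
  · intro b hb
    by_contra hne
    obtain ⟨y, hy, hy0⟩ := Submodule.exists_mem_ne_zero_of_ne_bot hne
    obtain ⟨r, rfl⟩ := Ideal.mem_span_singleton'.1 (hb.le hy)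
    have hi : (r * evIdem K i).seq i ≠ 0 := by
      intro h0
      apply hy0
      apply seq_ext_s11
      intro n
      by_cases hn : n = i
      · subst hn; simpa using h0
      · simp [hn]
    exact hb.not_ge ((Ideal.span_singleton_le_iff_mem _).2 (idem_mem_s11 b _ hy i hi))

theorem socle_eq : (moduleSocle (EvRing K) (EvRing K) : Ideal (EvRing K)) = finIdeal K := by
  apply le_antisymm
  · refine sSup_le ?_
    intro p hp x hx
    have hat := isSimpleModule_iff_isAtom.1 hp
    obtain ⟨N, c, hc⟩ := exists_lim x
    by_cases h0 : c = 0
    · exact ⟨N, fun n hn => by rw [hc n hn, h0]⟩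
    have hN : evIdem K N ∈ p := idem_mem_s11 p x hx N (by rw [hc N le_rfl]; exact h0)
    have hle : Ideal.span {evIdem K N} ≤ p := (Ideal.span_singleton_le_iff_mem _).2 hN
    have heq : Ideal.span {evIdem K N} = p :=
      (hat.le_iff.1 hle).resolve_left (isSimpleModule_iff_isAtom.1 (idem_simple N)).1
    rw [← heq] at hx
    obtain ⟨r, rfl⟩ := Ideal.mem_span_singleton'.1 hx
    exact ⟨N + 1, fun n hn => by simp [show n ≠ N by omega]⟩
  · rintro x ⟨N, hN⟩
    refine mem_of_fin_s11 _ x N hN fun n _ => ?_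
    have : Ideal.span {evIdem K n} ≤ moduleSocle (EvRing K) (EvRing K) :=
      le_sSup (idem_simple n)
    exact this (Ideal.mem_span_singleton_self _)

open Classical in
/-- Cut off the coordinates belonging to `I`. -/
noncomputable def cut (I : Ideal (EvRing K)) : finIdeal K →ₗ[EvRing K] EvRing K where
  toFun x := mk' (fun n => if evIdem K n ∈ I then 0 else x.1.seq n) (by
    obtain ⟨N, hN⟩ := x.2
    exact ⟨N, 0, fun n hn => by simp [hN n hn]⟩)
  map_add' x y := by
    apply seq_ext_s11
    intro n
    simp only [seq_mk', seq_add, Submodule.coe_add]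
    split_ifs <;> simp
  map_smul' c x := by
    apply seq_ext_s11
    intro n
    simp only [seq_mk', seq_mul_s11, Submodule.coe_smul, smul_eq_mul, RingHom.id_apply]
    split_ifs <;> simp

theorem cut_eq_zero (I : Ideal (EvRing K)) (x : finIdeal K) (hx : x.1 ∈ I) : cut I x = 0 := by
  apply seq_ext_s11
  intro n
  simp only [cut, LinearMap.coe_mk, AddHom.coe_mk, seq_mk', seq_zero_s11]
  split_ifs with h
  · rfl
  · by_contra h0
    exact h (idem_mem_s11 I _ hx n h0)

theorem sub_cut_mem (I : Ideal (EvRing K)) (x : finIdeal K) : cut I x - x.1 ∈ I := by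
  obtain ⟨N, hN⟩ := x.2
  refine mem_of_fin_s11 I _ N (fun n hn => ?_) fun n h => ?_
  · simp [cut, hN n hn]
  · by_contra h0
    apply h
    simp [cut, h0]

theorem lift_of_not_le {M : Type*} [AddCommGroup M] [Module (EvRing K) M] (I : Ideal (EvRing K))
    (hI : ¬ I ≤ finIdeal K) (f : M →ₗ[EvRing K] EvRing K ⧸ I) :
    ∃ g : M →ₗ[EvRing K] EvRing K, f = (Submodule.mkQ I).comp g := by
  classical
  obtain ⟨x, hx, hxF⟩ := SetLike.not_le_iff_exists.1 hI
  obtain ⟨N, c, hc⟩ := exists_lim x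
  have h0 : c ≠ 0 := fun h => hxF ⟨N, fun n hn => by rw [hc n hn, h]⟩
  have hA : ∀ n, N ≤ n → evIdem K n ∈ I := fun n hn =>
    idem_mem_s11 I x hx n (by rw [hc n hn]; exact h0)
  let e : EvRing K := mk' (fun n => if evIdem K n ∈ I then 1 else 0)
    ⟨N, 1, fun n hn => by simp [hA n hn]⟩
  have he : e ∈ I := by
    have h1 : e - (e * algebraMap K (EvRing K) c⁻¹) * x ∈ I := by
      refine mem_of_fin_s11 I _ N (fun n hn => ?_) fun n h => ?_
      · simp [e, hA n hn, hc n hn, h0]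
      · by_contra h2
        apply h
        simp [e, h2]
    have := I.add_mem h1 (I.mul_mem_left (e * algebraMap K (EvRing K) c⁻¹) hx)
    simpa using this
  let s : (EvRing K ⧸ I) →ₗ[EvRing K] EvRing K :=
    Submodule.liftQ I (LinearMap.mulLeft (EvRing K) (1 - e)) (by
      intro y hy
      rw [LinearMap.mem_ker]
      apply seq_ext_s11
      intro n
      simp only [LinearMap.mulLeft_apply, seq_mul_s11, seq_sub_s11, seq_one, seq_zero_s11, e, seq_mk']
      by_cases h : y.seq n = 0
      · simp [h]
      · simp [idem_mem_s11 I y hy n h])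
  refine ⟨s.comp f, ?_⟩
  ext m
  simp only [LinearMap.comp_apply]
  obtain ⟨y, hy⟩ := Submodule.mkQ_surjective I (f m)
  rw [← hy]
  simp only [s, Submodule.mkQ_apply, Submodule.liftQ_apply, LinearMap.mulLeft_apply]
  rw [Submodule.Quotient.eq]
  have : y - (1 - e) * y = y * e := by ring
  rw [this]
  exact I.mul_mem_left _ he

theorem lift_of_le {M : Type*} [AddCommGroup M] [Module (EvRing K) M] (I : Ideal (EvRing K))
    (hI : I ≤ finIdeal K)
    (H : ∀ f : M →ₗ[EvRing K] (EvRing K ⧸ finIdeal K),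
      ∃ g : M →ₗ[EvRing K] EvRing K, f = (Submodule.mkQ (finIdeal K)).comp g)
    (f : M →ₗ[EvRing K] EvRing K ⧸ I) :
    ∃ g : M →ₗ[EvRing K] EvRing K, f = (Submodule.mkQ I).comp g := by
  obtain ⟨g, hg⟩ := H ((Submodule.factor hI).comp f)
  have hx : ∀ m, ∃ x : finIdeal K, Submodule.mkQ I x.1 = f m - Submodule.mkQ I (g m) := by
    intro m
    obtain ⟨y, hy⟩ := Submodule.mkQ_surjective I (f m)
    have h1 := LinearMap.congr_fun hg m
    simp only [LinearMap.comp_apply] at h1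
    rw [← hy] at h1
    have h2 : y - g m ∈ finIdeal K := (Submodule.Quotient.eq _).1 h1
    exact ⟨⟨y - g m, h2⟩, by rw [← hy, map_sub]⟩
  choose x hx using hx
  have wd : ∀ a b : finIdeal K, Submodule.mkQ I a.1 = Submodule.mkQ I b.1 → cut I a = cut I b := by
    intro a b hab
    rw [← sub_eq_zero, ← map_sub]
    exact cut_eq_zero I _ ((Submodule.Quotient.eq _).1 hab)
  let h : M →ₗ[EvRing K] EvRing K :=
    { toFun := fun m => cut I (x m)
      map_add' := fun a b => by
        rw [← map_add]
        apply wd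
        rw [Submodule.coe_add, map_add, hx, hx, hx, map_add, map_add, map_add]
        abel
      map_smul' := fun r a => by
        rw [RingHom.id_apply, ← map_smul]
        apply wd
        rw [Submodule.coe_smul, map_smul, hx, hx, map_smul, map_smul, map_smul, smul_sub] }
  refine ⟨g + h, ?_⟩
  ext m
  have h3 : Submodule.mkQ I (cut I (x m)) = Submodule.mkQ I (x m).1 :=
    (Submodule.Quotient.eq _).2 (sub_cut_mem I _)
  have h4 : h m = cut I (x m) := rfl
  rw [LinearMap.comp_apply, LinearMap.add_apply, map_add, h4, h3, hx]
  abel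

end EvRing

/-- A module over the ring `R` of eventually constant sequences is `R`-projective iff it
is projective with respect to the canonical projection `π : R → R/Soc(R)`. -/
theorem evRing_rProjective_iff (K : Type*) [Field K]
    (M : Type v) [AddCommGroup M] [Module (EvRing K) M] :
    IsRProjective (EvRing K) M ↔
      ∀ f : M →ₗ[EvRing K]
          (EvRing K ⧸ (moduleSocle (EvRing K) (EvRing K) : Ideal (EvRing K))),
        ∃ g : M →ₗ[EvRing K] EvRing K,
          f = (Submodule.mkQ (moduleSocle (EvRing K) (EvRing K))).comp g := by
  constructor
  · intro h f
    exact h _ f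
  · intro H I f
    rw [EvRing.socle_eq] at H
    by_cases hI : I ≤ EvRing.finIdeal K
    · exact EvRing.lift_of_le I hI H f
    · exact EvRing.lift_of_not_le I hI f
end

section
/- Let R be any ring. Then every finitely generated R-projective right R-module is projective. -/
/-- A right `R`-module (here: a module over the opposite ring `Rᵐᵒᵖ`) is `R`-projective if
for every right ideal `I` of `R` (a submodule of `R` as a right module over itself), every
homomorphism `f : M → R/I` factors through the canonical projection `π : R → R/I`. -/
def IsRightRProjective (R : Type u) [Ring R] (M : Type v) [AddCommGroup M]
    [Module Rᵐᵒᵖ M] : Prop :=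
  ∀ (I : Submodule Rᵐᵒᵖ R) (f : M →ₗ[Rᵐᵒᵖ] R ⧸ I),
    ∃ g : M →ₗ[Rᵐᵒᵖ] R, f = (Submodule.mkQ I).comp g

theorem aux_base (R : Type u) [Ring R]
    (M : Type v) [AddCommGroup M] [Module Rᵐᵒᵖ M]
    (hM : IsRightRProjective R M) (Q : Type v) [AddCommGroup Q] [Module Rᵐᵒᵖ Q]
    (q : Q) (f : M →ₗ[Rᵐᵒᵖ] Q) (hf : ∀ m, f m ∈ Submodule.span Rᵐᵒᵖ {q}) :
    ∃ g : M →ₗ[Rᵐᵒᵖ] Rᵐᵒᵖ, ∀ m, f m = g m • q := by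
  let e : R →ₗ[Rᵐᵒᵖ] Rᵐᵒᵖ :=
    { toFun := MulOpposite.op
      map_add' := fun _ _ => rfl
      map_smul' := fun _ _ => rfl }
  let p : R →ₗ[Rᵐᵒᵖ] Q := (LinearMap.toSpanSingleton Rᵐᵒᵖ Q q).comp e
  have hr : ∀ m, f m ∈ LinearMap.range p := by
    intro m
    obtain ⟨a, ha⟩ := Submodule.mem_span_singleton.1 (hf m)
    exact ⟨a.unop, ha⟩
  obtain ⟨g, hg⟩ := hM (LinearMap.ker p)
    (p.quotKerEquivRange.symm.toLinearMap.comp (f.codRestrict _ hr))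
  refine ⟨e.comp g, fun m => ?_⟩
  have h := LinearMap.congr_fun hg m
  have h2 := congrArg (fun z => (p.quotKerEquivRange z : Q)) h
  have h3 : f m = p (g m) := by simpa using h2
  exact h3

theorem aux_step (R : Type u) [Ring R]
    (M : Type v) [AddCommGroup M] [Module Rᵐᵒᵖ M]
    (hM : IsRightRProjective R M) (n : ℕ) :
    ∀ (Q : Type v) [AddCommGroup Q] [Module Rᵐᵒᵖ Q]
    (x : Fin n → Q) (f : M →ₗ[Rᵐᵒᵖ] Q) (_ : ∀ m, f m ∈ Submodule.span Rᵐᵒᵖ (Set.range x)),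
    ∃ g : Fin n → (M →ₗ[Rᵐᵒᵖ] Rᵐᵒᵖ), ∀ m, f m = ∑ i, g i m • x i := by
  induction n with
  | zero =>
    intro Q _ _ x f hf
    refine ⟨fun _ => 0, fun m => ?_⟩
    have := hf m
    rw [Set.range_eq_empty, Submodule.span_empty, Submodule.mem_bot] at this
    simpa using this
  | succ n ih =>
    intro Q _ _ x f hf
    let K := Submodule.span Rᵐᵒᵖ {x 0}
    obtain ⟨g, hg⟩ := ih (Q ⧸ K) (fun i => K.mkQ (x i.succ)) (K.mkQ.comp f) (by
      intro m
      obtain ⟨c, hc⟩ := (Submodule.mem_span_range_iff_exists_fun _).1 (hf m)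
      refine (Submodule.mem_span_range_iff_exists_fun _).2 ⟨fun i => c i.succ, ?_⟩
      have h0 : K.mkQ (x 0) = 0 := by
        rw [Submodule.mkQ_apply, Submodule.Quotient.mk_eq_zero]
        exact Submodule.mem_span_singleton_self _
      rw [LinearMap.comp_apply, ← hc, Fin.sum_univ_succ, map_add, map_smul, h0, smul_zero,
        zero_add, map_sum]
      simp only [map_smul])
    obtain ⟨g0, h0⟩ := aux_base R M hM Q (x 0)
      (f - ∑ i, (LinearMap.toSpanSingleton Rᵐᵒᵖ Q (x i.succ)).comp (g i)) (by
        intro m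
        change _ ∈ K
        rw [← Submodule.Quotient.mk_eq_zero, ← Submodule.mkQ_apply, LinearMap.sub_apply, map_sub,
          sub_eq_zero]
        have := hg m
        rw [LinearMap.comp_apply] at this
        rw [this, LinearMap.sum_apply, map_sum]
        simp only [LinearMap.comp_apply, LinearMap.toSpanSingleton_apply, map_smul])
    refine ⟨Fin.cons g0 g, fun m => ?_⟩
    have := h0 m
    rw [LinearMap.sub_apply, sub_eq_iff_eq_add, LinearMap.sum_apply] at this
    rw [Fin.sum_univ_succ, this]
    simp

/-- Over any ring `R`, every finitely generated `R`-projective right `R`-module is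
projective. -/
theorem fg_rightRProjective_projective (R : Type u) [Ring R]
    (M : Type v) [AddCommGroup M] [Module Rᵐᵒᵖ M] [Module.Finite Rᵐᵒᵖ M]
    (hM : IsRightRProjective R M) :
    Module.Projective Rᵐᵒᵖ M := by
  obtain ⟨n, x, hx⟩ := Module.Finite.exists_fin (R := Rᵐᵒᵖ) (M := M)
  obtain ⟨g, hg⟩ := aux_step R M hM n M x LinearMap.id (fun m => by rw [hx]; trivial)
  refine Module.Projective.of_split (P := M) (M := Fin n → Rᵐᵒᵖ) (LinearMap.pi g)
    (∑ i, (LinearMap.toSpanSingleton Rᵐᵒᵖ M (x i)).comp (LinearMap.proj i)) ?_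
  ext m
  simpa [LinearMap.sum_apply] using (hg m).symm
end

section
/- Let R be any ring and M an R-projective right R-module. Then for every n ∈ ℕ, every submodule N ⊆ R^n, and every homomorphism f : M → R^n/N, there exists a homomorphism g : M → R^n such that f = π_N ∘ g, where π_N : R^n → R^n/N is the canonical projection. -/
/-- Auxiliary: every map from `M` to a quotient of `A` lifts to `A`. -/
def LiftsAlong (S : Type u) [Ring S] (M : Type v) [AddCommGroup M] [Module S M]
    (A : Type u) [AddCommGroup A] [Module S A] : Prop :=
  ∀ (C : Type u) [AddCommGroup C] [Module S C] (q : A →ₗ[S] C),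
    Function.Surjective q → ∀ f : M →ₗ[S] C, ∃ g : M →ₗ[S] A, q.comp g = f

theorem LiftsAlong.prod {S : Type u} [Ring S] {M : Type v} [AddCommGroup M] [Module S M]
    {A B : Type u} [AddCommGroup A] [Module S A] [AddCommGroup B] [Module S B]
    (hA : LiftsAlong S M A) (hB : LiftsAlong S M B) : LiftsAlong S M (A × B) := by
  intro C _ _ q hq f
  let q2 : B →ₗ[S] C := q.comp (LinearMap.inr S A B)
  let D : Submodule S C := LinearMap.range q2
  let q1 : A →ₗ[S] C ⧸ D := D.mkQ.comp (q.comp (LinearMap.inl S A B))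
  have split : ∀ a b, q (a, b) = q (a, 0) + q (0, b) := by
    intro a b
    rw [← map_add]
    simp
  have hq1 : Function.Surjective q1 := by
    intro c
    obtain ⟨c, rfl⟩ := D.mkQ_surjective c
    obtain ⟨⟨a, b⟩, rfl⟩ := hq c
    refine ⟨a, ?_⟩
    change D.mkQ (q (a, 0)) = D.mkQ (q (a, b))
    rw [split a b, map_add]
    have : D.mkQ (q (0, b)) = 0 := by
      rw [Submodule.mkQ_apply, Submodule.Quotient.mk_eq_zero]
      exact ⟨b, rfl⟩
    rw [this, add_zero]
  obtain ⟨g1, hg1⟩ := hA _ q1 hq1 (D.mkQ.comp f)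
  let f2 : M →ₗ[S] C := f - (q.comp (LinearMap.inl S A B)).comp g1
  have hf2 : ∀ m, f2 m ∈ D := by
    intro m
    rw [← Submodule.Quotient.mk_eq_zero, ← Submodule.mkQ_apply]
    change D.mkQ (f m - q (g1 m, 0)) = 0
    rw [map_sub, sub_eq_zero]
    exact (LinearMap.congr_fun hg1 m).symm
  obtain ⟨g2, hg2⟩ := hB _ q2.rangeRestrict q2.surjective_rangeRestrict (f2.codRestrict D hf2)
  refine ⟨g1.prod g2, ?_⟩
  ext m
  have h2 : q (0, g2 m) = f m - q (g1 m, 0) := congrArg Subtype.val (LinearMap.congr_fun hg2 m)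
  change q (g1 m, g2 m) = f m
  rw [split, h2]
  abel

theorem LiftsAlong.of_equiv {S : Type u} [Ring S] {M : Type v} [AddCommGroup M] [Module S M]
    {A B : Type u} [AddCommGroup A] [Module S A] [AddCommGroup B] [Module S B]
    (e : A ≃ₗ[S] B) (hA : LiftsAlong S M A) : LiftsAlong S M B := by
  intro C _ _ q hq f
  obtain ⟨g, hg⟩ := hA C (q.comp e.toLinearMap) (hq.comp e.surjective) f
  exact ⟨e.toLinearMap.comp g, hg⟩

theorem liftsAlong_base (R : Type u) [Ring R]
    (M : Type v) [AddCommGroup M] [Module Rᵐᵒᵖ M] (hM : IsRightRProjective R M) :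
    LiftsAlong Rᵐᵒᵖ M R := by
  intro C _ _ q hq f
  let e := q.quotKerEquivOfSurjective hq
  obtain ⟨g, hg⟩ := hM (LinearMap.ker q) (e.symm.toLinearMap.comp f)
  refine ⟨g, ?_⟩
  ext m
  have h : e.symm (f m) = (LinearMap.ker q).mkQ (g m) := LinearMap.congr_fun hg m
  rw [LinearEquiv.symm_apply_eq] at h
  exact h.symm

theorem liftsAlong_pow (R : Type u) [Ring R]
    (M : Type v) [AddCommGroup M] [Module Rᵐᵒᵖ M] (hM : IsRightRProjective R M) (n : ℕ) :
    LiftsAlong Rᵐᵒᵖ M (Fin n → R) := by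
  induction n with
  | zero =>
    intro C _ _ q hq f
    refine ⟨0, ?_⟩
    ext m
    obtain ⟨x, hx⟩ := hq (f m)
    rw [← hx]
    exact congrArg q (Subsingleton.elim _ x)
  | succ n ih =>
    exact ((liftsAlong_base R M hM).prod ih).of_equiv
      (Fin.consLinearEquiv Rᵐᵒᵖ (fun _ : Fin (n + 1) => R))

/-- If `M` is an `R`-projective right `R`-module, then for every `n`, every submodule
`N ⊆ Rⁿ` and every homomorphism `f : M → Rⁿ/N` there is `g : M → Rⁿ` with
`f = π_N ∘ g`, where `π_N : Rⁿ → Rⁿ/N` is the canonical projection. -/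
theorem rightRProjective_finite_power (R : Type u) [Ring R]
    (M : Type v) [AddCommGroup M] [Module Rᵐᵒᵖ M] (hM : IsRightRProjective R M) :
    ∀ (n : ℕ) (N : Submodule Rᵐᵒᵖ (Fin n → R)) (f : M →ₗ[Rᵐᵒᵖ] (Fin n → R) ⧸ N),
      ∃ g : M →ₗ[Rᵐᵒᵖ] (Fin n → R), f = (Submodule.mkQ N).comp g := by
  intro n N f
  obtain ⟨g, hg⟩ := liftsAlong_pow R M hM n _ N.mkQ N.mkQ_surjective f
  exact ⟨g, hg.symm⟩
end

section
/- Let R be a ring that is right self-injective (R is injective as a right module over itself). Then a right R-module M is R-projective if and only if Ext^1_R(M, I) = 0 for every right ideal I of R. -/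
open CategoryTheory

/-- If `R` is right self-injective, then a right `R`-module `M` is `R`-projective if and
only if `Ext¹_R(M, I) = 0` for every right ideal `I` of `R`. -/
theorem rightRProjective_iff_ext_vanishes (R : Type u) [Ring R]
    (hRinj : Module.Injective Rᵐᵒᵖ R)
    (M : Type u) [AddCommGroup M] [Module Rᵐᵒᵖ M] :
    letI := HasDerivedCategory.standard (ModuleCat.{u} Rᵐᵒᵖ)
    letI : HasExt.{u + 1} (ModuleCat.{u} Rᵐᵒᵖ) := hasExt_of_hasDerivedCategory _
    (IsRightRProjective R M ↔
      ∀ I : Submodule Rᵐᵒᵖ R,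
        Subsingleton (Abelian.Ext (ModuleCat.of Rᵐᵒᵖ M) (ModuleCat.of Rᵐᵒᵖ I) 1)) := by
  letI := HasDerivedCategory.standard (ModuleCat.{u} Rᵐᵒᵖ)
  letI : HasExt.{u + 1} (ModuleCat.{u} Rᵐᵒᵖ) := hasExt_of_hasDerivedCategory _
  change (IsRightRProjective R M ↔
      ∀ I : Submodule Rᵐᵒᵖ R,
        Subsingleton (Abelian.Ext (ModuleCat.of Rᵐᵒᵖ M) (ModuleCat.of Rᵐᵒᵖ I) 1))
  haveI hinj : Injective (ModuleCat.of Rᵐᵒᵖ R) :=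
    Module.injective_object_of_injective_module Rᵐᵒᵖ R
  refine forall_congr' fun I => ?_
  let S : ShortComplex (ModuleCat.{u} Rᵐᵒᵖ) :=
    ShortComplex.mk (ModuleCat.ofHom I.subtype) (ModuleCat.ofHom I.mkQ) (by
      ext x; simp)
  have hS : S.ShortExact :=
    { exact := by
        rw [ShortComplex.ShortExact.moduleCat_exact_iff_function_exact]
        exact LinearMap.exact_subtype_mkQ I
      mono_f := (ModuleCat.mono_iff_injective _).2 Subtype.val_injective
      epi_g := (ModuleCat.epi_iff_surjective _).2 (Submodule.mkQ_surjective I) }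
  constructor
  · intro h
    refine subsingleton_of_forall_eq 0 fun x => ?_
    obtain ⟨y, hy⟩ := Abelian.Ext.covariant_sequence_exact₁ (ModuleCat.of Rᵐᵒᵖ M) hS x
      (Abelian.Ext.eq_zero_of_injective (I := ModuleCat.of Rᵐᵒᵖ R) _) (zero_add 1)
    obtain ⟨f, rfl⟩ := (Abelian.Ext.mk₀_bijective _ _).2 y
    obtain ⟨g, hg⟩ := h f.hom
    have hf : f = ModuleCat.ofHom g ≫ S.g := by
      ext x
      exact LinearMap.congr_fun hg x
    rw [← hy, hf, ← Abelian.Ext.mk₀_comp_mk₀, Abelian.Ext.comp_assoc_of_second_deg_zero,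
      hS.comp_extClass, Abelian.Ext.comp_zero]
  · intro h f
    obtain ⟨y, hy⟩ := Abelian.Ext.covariant_sequence_exact₃ (ModuleCat.of Rᵐᵒᵖ M) hS
      (Abelian.Ext.mk₀ (ModuleCat.ofHom f)) (zero_add 1) (h.elim _ _)
    obtain ⟨g, rfl⟩ := (Abelian.Ext.mk₀_bijective _ _).2 y
    rw [Abelian.Ext.mk₀_comp_mk₀] at hy
    have := (Abelian.Ext.mk₀_bijective _ _).1 hy
    exact ⟨g.hom, (congrArg ModuleCat.Hom.hom this).symm⟩
end

section
/- Let R be the direct product ∏_{i∈I} D_i of an infinite family of division rings D_i. Then every countably generated R-projective right R-module is projective. -/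
namespace ProdDiv

open MulOpposite

section
variable {ι : Type u} {D : ι → Type u} [∀ i, DivisionRing (D i)]

/-- The central idempotent attached to a subset of the index set. -/
noncomputable def idem (D : ι → Type u) [∀ i, DivisionRing (D i)] (A : Set ι) :
    (∀ i, D i)ᵐᵒᵖ := by
  classical
  exact op (fun i => if i ∈ A then 1 else 0)

lemma opext {a b : (∀ i, D i)ᵐᵒᵖ} (h : ∀ i, unop a i = unop b i) : a = b :=
  unop_injective (funext h)

lemma unop_idem_of_mem {A : Set ι} {i : ι} (h : i ∈ A) : unop (idem D A) i = 1 := by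
  simp [idem, h]

lemma unop_idem_of_notMem {A : Set ι} {i : ι} (h : i ∉ A) : unop (idem D A) i = 0 := by
  simp [idem, h]

lemma idem_comm (A : Set ι) (r : (∀ i, D i)ᵐᵒᵖ) : idem D A * r = r * idem D A := by
  apply opext
  intro i
  by_cases h : i ∈ A
  · simp [unop_idem_of_mem h]
  · simp [unop_idem_of_notMem h]

lemma idem_sq (A : Set ι) : idem D A * idem D A = idem D A := by
  apply opext
  intro i
  by_cases h : i ∈ A
  · simp [unop_idem_of_mem h]
  · simp [unop_idem_of_notMem h]

/-- Quasi-inverse. -/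
lemma exists_quasi_inv (r : (∀ i, D i)ᵐᵒᵖ) :
    ∃ (r' : (∀ i, D i)ᵐᵒᵖ) (A : Set ι), r' * r = idem D A ∧ idem D A * r = r := by
  refine ⟨op (fun i => (unop r i)⁻¹), {i | unop r i ≠ 0}, ?_, ?_⟩
  · apply opext
    intro i
    by_cases h : unop r i = 0
    · rw [unop_idem_of_notMem (by simpa using h)]
      simp [h]
    · rw [unop_idem_of_mem (by simpa using h)]
      simp [h]
  · apply opext
    intro i
    by_cases h : unop r i = 0
    · simp [h]
    · simp [unop_idem_of_mem (show i ∈ {i | unop r i ≠ 0} from h)]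

variable {M : Type v} [AddCommGroup M] [Module (∀ i, D i)ᵐᵒᵖ M]

lemma nonsing (hM : IsRightRProjective (∀ i, D i) M) (x : M)
    (hx : ∀ i, idem D {i} • x = 0) : x = 0 := by
  by_contra hx0
  obtain ⟨K, -, hK⟩ := zorn_le_nonempty₀ {K : Submodule (∀ i, D i)ᵐᵒᵖ M | x ∉ K}
    (fun c hc hchain y hy => ⟨sSup c, by
      intro hmem
      rw [Submodule.mem_sSup_of_directed ⟨y, hy⟩ hchain.directedOn] at hmem
      obtain ⟨z, hz, hxz⟩ := hmem
      exact hc hz hxz, fun z hz => le_sSup hz⟩) ⊥ (by simpa using hx0)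
  have hxK : x ∉ K := hK.prop
  have key : ∀ m : M, m ∉ K → ∃ r : (∀ i, D i)ᵐᵒᵖ, r • m - x ∈ K := by
    intro m hm
    by_contra hcon
    push Not at hcon
    apply hm
    refine hK.le_of_ge (y := K ⊔ Submodule.span _ {m}) ?_ le_sup_left
      (Submodule.mem_sup_right (Submodule.mem_span_singleton_self m))
    intro hmem
    obtain ⟨k, hk, z, hz, hkz⟩ := Submodule.mem_sup.1 hmem
    obtain ⟨r, rfl⟩ := Submodule.mem_span_singleton.1 hz
    apply hcon r
    rw [← hkz]
    simpa using hk
  -- each idempotent acts as zero or one modulo `K`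
  have dich : ∀ A : Set ι, (∀ m : M, idem D A • m ∈ K) ∨ (∀ m : M, m - idem D A • m ∈ K) := by
    intro A
    by_contra! hcon
    obtain ⟨⟨m, hm⟩, m', hm'⟩ := hcon
    obtain ⟨r, hr⟩ := key _ hm
    obtain ⟨r', hr'⟩ := key _ hm'
    apply hxK
    have h1 := K.smul_mem (1 - idem D A) hr
    have h2 := K.smul_mem (idem D A) hr'
    have e1 : (1 - idem D A) • (r • idem D A • m - x) = - (x - idem D A • x) := by
      have : (1 - idem D A) * (r * idem D A) = 0 := by
        rw [← idem_comm, ← mul_assoc, sub_mul, idem_sq]; simp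
      rw [smul_sub, smul_smul r, smul_smul, this, sub_smul]; simp
    have e2 : idem D A • (r' • (m' - idem D A • m') - x) = - (idem D A • x) := by
      have : idem D A * (r' * (1 - idem D A)) = 0 := by
        rw [← mul_assoc, idem_comm, mul_assoc, mul_sub, idem_sq]; simp
      have h3 : m' - idem D A • m' = (1 - idem D A) • m' := by rw [sub_smul, one_smul]
      rw [h3, smul_sub, smul_smul r', smul_smul, this]; simp
    rw [e1] at h1
    rw [e2] at h2
    have := K.neg_mem (K.add_mem h1 h2)
    simpa using this
  have gen : ∀ m : M, ∃ r : (∀ i, D i)ᵐᵒᵖ, m - r • x ∈ K := by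
    intro m
    by_cases hm : m ∈ K
    · exact ⟨0, by simpa using hm⟩
    obtain ⟨r, hr⟩ := key m hm
    obtain ⟨r', A, h1, h2⟩ := exists_quasi_inv r
    rcases dich A with h | h
    · exfalso
      apply hxK
      have := h (r • m)
      rw [smul_smul, h2] at this
      have := K.sub_mem this hr
      simpa using this
    · refine ⟨r', ?_⟩
      have a := h m
      have b := K.smul_mem r' hr
      rw [smul_sub, smul_smul, h1] at b
      have := K.add_mem a b
      simpa using this
  let φ : (∀ i, D i) →ₗ[(∀ i, D i)ᵐᵒᵖ] M ⧸ K :=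
    { toFun := fun r => op r • K.mkQ x
      map_add' := fun a b => by rw [op_add, add_smul]
      map_smul' := fun a b => by
        rw [RingHom.id_apply, smul_smul]; rfl }
  have hφ : Function.Surjective φ := by
    intro q
    obtain ⟨m, rfl⟩ := K.mkQ_surjective q
    obtain ⟨r, hr⟩ := gen m
    refine ⟨unop r, ?_⟩
    change op (unop r) • K.mkQ x = K.mkQ m
    rw [op_unop, ← map_smul]
    exact ((Submodule.Quotient.eq K).2 hr).symm
  let e := φ.quotKerEquivOfSurjective hφ
  obtain ⟨g, hg⟩ := hM (LinearMap.ker φ) (e.symm.toLinearMap.comp K.mkQ)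
  have hgx : g x = 0 := by
    funext i
    have h := g.map_smul (idem D {i}) x
    rw [hx i, map_zero] at h
    have h := congrFun h i
    have h' : (idem D {i} • g x) i = g x i * unop (idem D {i}) i := rfl
    rw [h', unop_idem_of_mem (Set.mem_singleton i), mul_one] at h
    exact h.symm
  have h := LinearMap.congr_fun hg x
  simp only [LinearMap.comp_apply, hgx, map_zero] at h
  have h' : K.mkQ x = 0 := by simpa using h
  exact hxK (by simpa using h')

lemma proj_of_nonsing (hns : ∀ x : M, (∀ i, idem D {i} • x = 0) → x = 0) (x : ℕ → M)
    (hspan : Submodule.span (∀ i, D i)ᵐᵒᵖ (Set.range x) = ⊤) :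
    Module.Projective (∀ i, D i)ᵐᵒᵖ M := by
  classical
  let N : ℕ → Submodule (∀ i, D i)ᵐᵒᵖ M := fun n => Submodule.span _ (x '' (Finset.range n))
  let A : ℕ → Set ι := fun n => {i | idem D {i} • x n ∉ N n}
  let y : ℕ → M := fun n => idem D (A n) • x n
  have hEy : ∀ n, idem D (A n) • y n = y n := fun n => by
    simp only [y, smul_smul, idem_sq]
  have hrem : ∀ n, x n - y n ∈ N n := by
    intro n
    have hc : ∀ i, ∃ c : ℕ → (∀ i, D i)ᵐᵒᵖ, i ∉ A n →
        ∑ k ∈ Finset.range n, c k • x k = idem D {i} • x n := by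
      intro i
      by_cases hi : i ∈ A n
      · exact ⟨0, fun h => absurd hi h⟩
      · have hi' : idem D {i} • x n ∈ N n := by simpa [A] using hi
        obtain ⟨c, hc⟩ := (Submodule.mem_span_image_finset_iff_exists_fun _).1 hi'
        refine ⟨fun k => if h : k ∈ Finset.range n then c ⟨k, h⟩ else 0, fun _ => ?_⟩
        rw [← hc, ← Finset.sum_coe_sort]
        refine Finset.sum_congr rfl fun k _ => ?_
        beta_reduce; rw [dif_pos k.2]
    choose c hc using hc
    let r : ℕ → (∀ i, D i)ᵐᵒᵖ := fun k => op (fun i => if i ∈ A n then 0 else unop (c i k) i)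
    have : x n - y n = ∑ k ∈ Finset.range n, r k • x k := by
      rw [← sub_eq_zero]
      apply hns
      intro i
      rw [smul_sub, smul_sub, Finset.smul_sum, smul_smul]
      simp only [smul_smul]
      by_cases hi : i ∈ A n
      · have h1 : idem D {i} * idem D (A n) = idem D {i} := by
          apply opext
          intro j
          by_cases hj : j = i
          · subst hj; simp [unop_idem_of_mem hi]
          · simp [unop_idem_of_notMem (show j ∉ ({i} : Set ι) from hj)]
        have h2 : ∀ k, idem D {i} * r k = 0 := by
          intro k
          apply opext
          intro j
          by_cases hj : j = i
          · subst hj; simp [r, hi]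
          · simp [unop_idem_of_notMem (show j ∉ ({i} : Set ι) from hj)]
        simp [h1, h2]
      · have h1 : idem D {i} * idem D (A n) = 0 := by
          apply opext
          intro j
          by_cases hj : j = i
          · subst hj; simp [unop_idem_of_notMem hi]
          · simp [unop_idem_of_notMem (show j ∉ ({i} : Set ι) from hj)]
        have h2 : ∀ k, idem D {i} * r k = idem D {i} * c i k := by
          intro k
          apply opext
          intro j
          by_cases hj : j = i
          · subst hj; simp [r, hi]
          · simp [unop_idem_of_notMem (show j ∉ ({i} : Set ι) from hj)]
        simp only [h1, h2, zero_smul, sub_zero, ← smul_smul]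
        rw [← Finset.smul_sum, hc i hi, smul_smul, idem_sq, sub_self]
    rw [this]
    exact Submodule.sum_mem _ fun k hk => Submodule.smul_mem _ _
      (Submodule.subset_span ⟨k, hk, rfl⟩)
  have hxy : ∀ n, x n ∈ Submodule.span (∀ i, D i)ᵐᵒᵖ (Set.range y) := by
    intro n
    induction n using Nat.strong_induction_on with
    | _ n ih =>
      have h1 : N n ≤ Submodule.span (∀ i, D i)ᵐᵒᵖ (Set.range y) := by
        rw [Submodule.span_le]
        rintro _ ⟨k, hk, rfl⟩
        exact ih k (by simpa using hk)
      have := Submodule.add_mem _ (h1 (hrem n)) (Submodule.subset_span ⟨n, rfl⟩)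
      simpa using this
  let π : (ℕ →₀ (∀ i, D i)ᵐᵒᵖ) →ₗ[(∀ i, D i)ᵐᵒᵖ] M := Finsupp.linearCombination _ y
  have hπ : Function.Surjective π := by
    rw [← LinearMap.range_eq_top, Finsupp.range_linearCombination, eq_top_iff, ← hspan,
      Submodule.span_le]
    rintro _ ⟨n, rfl⟩
    exact hxy n
  let P : (ℕ →₀ (∀ i, D i)ᵐᵒᵖ) →ₗ[(∀ i, D i)ᵐᵒᵖ] (ℕ →₀ (∀ i, D i)ᵐᵒᵖ) :=
    Finsupp.linearCombination _ (fun n => Finsupp.single n (idem D (A n)))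
  have hP : ∀ r n, P r n = r n * idem D (A n) := by
    intro r n
    simp only [P, Finsupp.linearCombination_apply, Finsupp.sum, Finsupp.smul_single,
      smul_eq_mul, Finsupp.finsetSum_apply, Finsupp.single_apply]
    rw [Finset.sum_ite_eq' r.support n (fun k => r k * idem D (A k))]
    split_ifs with h
    · rfl
    · rw [Finsupp.notMem_support_iff.1 h, zero_mul]
  have hπP : π.comp P = π := by
    ext n
    simp [P, π, hEy]
  have hker : LinearMap.ker π ≤ LinearMap.ker P := by
    intro r hr
    rw [LinearMap.mem_ker] at hr ⊢
    by_contra hne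
    have hex : ∃ n i, unop (P r n) i ≠ 0 := by
      by_contra! hcon
      exact hne (Finsupp.ext fun n => opext fun i => by simpa using hcon n i)
    obtain ⟨n0, i, hn0⟩ := hex
    let T := (P r).support.filter (fun n => unop (P r n) i ≠ 0)
    have hT : T.Nonempty := ⟨n0, by
      refine Finset.mem_filter.2 ⟨Finsupp.mem_support_iff.2 fun h => hn0 (by simp [h]), hn0⟩⟩
    obtain ⟨n, hnT, hmax⟩ := T.exists_max_image id hT
    have hn : unop (P r n) i ≠ 0 := (Finset.mem_filter.1 hnT).2
    have hnA : i ∈ A n := by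
      by_contra h
      apply hn
      rw [hP]
      simp [unop_idem_of_notMem h]
    have hz : ∀ k, n < k → idem D {i} * P r k = 0 := by
      intro k hk
      apply opext
      intro j
      by_cases hj : j = i
      · subst hj
        have : unop (P r k) j = 0 := by
          by_contra h
          have hkT : k ∈ T := Finset.mem_filter.2
            ⟨Finsupp.mem_support_iff.2 fun h' => h (by simp [h']), h⟩
          exact absurd (hmax k hkT) (by simpa using hk)
        simp [this]
      · simp [unop_idem_of_notMem (show j ∉ ({i} : Set ι) from hj)]
    have hsum : ∑ k ∈ (P r).support, (idem D {i} * P r k) • y k = 0 := by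
      have h0 : π (P r) = 0 := by
        rw [← LinearMap.comp_apply, hπP, hr]
      have h1 : π (P r) = ∑ k ∈ (P r).support, P r k • y k := by
        simp only [π, Finsupp.linearCombination_apply, Finsupp.sum]
      have := congrArg (fun m => idem D {i} • m) (h1.symm.trans h0)
      simpa only [Finset.smul_sum, smul_smul, smul_zero] using this
    have hnS : n ∈ (P r).support := (Finset.mem_filter.1 hnT).1
    have hrest : ∑ k ∈ (P r).support.erase n, (idem D {i} * P r k) • y k ∈ N n := by
      apply Submodule.sum_mem
      intro k hk
      rcases lt_or_gt_of_ne (Finset.ne_of_mem_erase hk) with h | h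
      · exact Submodule.smul_mem _ _ (Submodule.smul_mem _ _
          (Submodule.subset_span ⟨k, by simpa using h, rfl⟩))
      · rw [hz k h, zero_smul]
        exact Submodule.zero_mem _
    rw [← Finset.add_sum_erase _ _ hnS] at hsum
    have hmem : (idem D {i} * P r n) • y n ∈ N n := by
      rw [eq_neg_of_add_eq_zero_left hsum]
      exact Submodule.neg_mem _ hrest
    apply hnA
    have h2 := Submodule.smul_mem (N n) (op (fun j => (unop (P r n) j)⁻¹)) hmem
    have h3 : op (fun j => (unop (P r n) j)⁻¹) * (idem D {i} * P r n * idem D (A n))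
        = idem D {i} := by
      apply opext
      intro j
      by_cases hj : j = i
      · subst hj
        simp [unop_idem_of_mem hnA, unop_idem_of_mem (Set.mem_singleton j), hn]
      · simp [unop_idem_of_notMem (show j ∉ ({i} : Set ι) from hj)]
    simp only [y] at h2
    rw [smul_smul, smul_smul, mul_assoc, h3] at h2
    exact h2
  let e := π.quotKerEquivOfSurjective hπ
  let s : M →ₗ[(∀ i, D i)ᵐᵒᵖ] (ℕ →₀ (∀ i, D i)ᵐᵒᵖ) :=
    ((LinearMap.ker π).liftQ P hker).comp e.symm.toLinearMap
  refine Module.Projective.of_split s π ?_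
  ext m
  obtain ⟨r, rfl⟩ := hπ m
  have h1 : e.symm (π r) = (LinearMap.ker π).mkQ r := by
    rw [LinearEquiv.symm_apply_eq]
    rfl
  have h2 : s (π r) = P r := by
    simp only [s, LinearMap.comp_apply, LinearEquiv.coe_coe, h1]
    simp
  rw [LinearMap.comp_apply, h2, ← LinearMap.comp_apply, hπP]
  rfl

end

end ProdDiv

/-- If `R = ∏_{i∈ι} D i` is the direct product of an infinite family of division rings,
then every countably generated `R`-projective right `R`-module is projective. -/
theorem prod_divisionRings_countably_generated_projective
    (ι : Type u) [Infinite ι] (D : ι → Type u) [∀ i, DivisionRing (D i)]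
    (M : Type v) [AddCommGroup M] [Module (∀ i, D i)ᵐᵒᵖ M]
    (hM : IsRightRProjective (∀ i, D i) M)
    (hcg : ∃ s : Set M, s.Countable ∧ Submodule.span (∀ i, D i)ᵐᵒᵖ s = ⊤) :
    Module.Projective (∀ i, D i)ᵐᵒᵖ M := by
  obtain ⟨s, hs, hspan⟩ := hcg
  obtain ⟨x, hx⟩ := (hs.insert 0).exists_eq_range (Set.insert_nonempty _ _)
  refine ProdDiv.proj_of_nonsing (ProdDiv.nonsing hM) x ?_
  rw [← hx, eq_top_iff, ← hspan]
  exact Submodule.span_mono (Set.subset_insert _ _)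
end
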